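/- arXiv:0903.2695 — 3 statements merged into one kernel-verified Lean document; each statement's English description precedes it below -/
import Mathlib

section
/- Let m ≥ 1, let a_1, …, a_m > 0 and q_1, …, q_m ∈ (0,1) with ∑_{j=1}^m a_j / (1 − q_j) < 1. If μ ∈ ℝ satisfies μ ≠ q_j for all j and ∑_{j=1}^m a_j / (μ − q_j) = 1, then −1 < μ < 1. -/
/-- If `a j > 0`, `q j ∈ (0,1)` and `∑ j a j / (1 - q j) < 1`, then any real
solution `μ` (distinct from every `q j`) of `∑ j a j / (μ - q j) = 1` satisfies
`-1 < μ < 1`. -/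
theorem stmt_6 (m : ℕ) (hm : 1 ≤ m) (a q : Fin m → ℝ) (ha : ∀ j, 0 < a j)
    (hq : ∀ j, q j ∈ Set.Ioo (0 : ℝ) 1)
    (hload : ∑ j, a j / (1 - q j) < 1)
    (μ : ℝ) (hμ : ∀ j, μ ≠ q j)
    (heq : ∑ j, a j / (μ - q j) = 1) :
    -1 < μ ∧ μ < 1 := by
  constructor
  · by_contra! h
    have hsum : ∑ j, a j / (μ - q j) ≤ 0 := Finset.sum_nonpos fun j _ =>
      div_nonpos_of_nonneg_of_nonpos (ha j).le (by linarith [(hq j).1])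
    linarith
  · by_contra! h
    have hsum : ∑ j, a j / (μ - q j) ≤ ∑ j, a j / (1 - q j) := Finset.sum_le_sum fun j _ =>
      div_le_div_of_nonneg_left (ha j).le (by linarith [(hq j).2]) (by linarith)
    linarith
end

section
/- Let m ≥ 1, let λ̂_1, …, λ̂_m > 0, p_1, …, p_m ∈ (0,1), s̄_1, …, s̄_m > 0 with ρ := ∑_{j=1}^m λ̂_j s̄_j < 1, and let c > 0. Define the m × m matrices A and B by A_{αj} = λ̂_α p_j s̄_j + (1−p_α) δ_{αj} and B_{αj} = c λ̂_α p_j. Then every sequence x : ℕ → ℝ^m with x_α(i) ≥ 0 for all α and i, satisfying componentwise for all i the recursive inequality x_α(i+1) ≤ ∑_{j=1}^m A_{αj} x_j(i) + ∑_{j=1}^m B_{αj} √(x_j(i)), is bounded and satisfies, for every α ∈ {1,…,m}, limsup_{i→∞} x_α(i) ≤ (c^2 / (1−ρ)^2) (λ̂_α / p_α) (∑_{j=1}^m √(λ̂_j p_j))^2. -/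
/-- One step of the recursion, applied to a vector dominated by a multiple `Y` of `λ̂ / p`, gives
a vector whose distance to the fixed point `K = (c S / (1 - ρ))²` has contracted. -/
theorem separateQueues_step_le {ι : Type*} [Fintype ι] [DecidableEq ι] {lamh p s : ι → ℝ}
    (hlamh : ∀ j, 0 < lamh j) (hp : ∀ j, 0 < p j) (hp1 : ∀ j, p j ≤ 1) (hs : ∀ j, 0 ≤ s j)
    {ρ c : ℝ} (hρ : ρ = ∑ j, lamh j * s j) (hload : ρ < 1) (hc : 0 ≤ c)
    {z : ι → ℝ} {Y : ℝ} (hY : 0 ≤ Y) (hz : ∀ j, z j ≤ lamh j / p j * Y) (α : ι) :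
    (∑ j, (lamh α * p j * s j + (if α = j then 1 - p α else 0)) * z j) +
        ∑ j, (c * lamh α * p j) * Real.sqrt (z j) ≤
      lamh α / p α * (Y - p α * ((1 - ρ) / 2) *
        (Y - (c * (∑ j, Real.sqrt (lamh j * p j)) / (1 - ρ)) ^ 2)) := by
  set S := ∑ j, Real.sqrt (lamh j * p j) with hS
  have hρ1 : 0 < 1 - ρ := sub_pos.2 hload
  have hdiag : ∑ j, (lamh α * p j * s j + (if α = j then 1 - p α else 0)) * z j =
      lamh α * (∑ j, p j * s j * z j) + (1 - p α) * z α := by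
    simp only [add_mul, Finset.sum_add_distrib, ite_mul, zero_mul, Finset.sum_ite_eq,
      Finset.mem_univ, if_true, Finset.mul_sum, mul_assoc]
  have hlin : ∑ j, p j * s j * z j ≤ ρ * Y := by
    rw [hρ, Finset.sum_mul]
    refine Finset.sum_le_sum fun j _ => ?_
    have hpj := (hp j).ne'
    calc p j * s j * z j ≤ p j * s j * (lamh j / p j * Y) :=
          mul_le_mul_of_nonneg_left (hz j) (mul_nonneg (hp j).le (hs j))
      _ = lamh j * s j * Y := by field_simp
  have hsqrt : ∑ j, p j * Real.sqrt (z j) ≤ S * Real.sqrt Y := by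
    rw [hS, Finset.sum_mul]
    refine Finset.sum_le_sum fun j _ => ?_
    have hpj := (hp j).ne'
    calc p j * Real.sqrt (z j) ≤ p j * Real.sqrt (lamh j / p j * Y) :=
          mul_le_mul_of_nonneg_left (Real.sqrt_le_sqrt (hz j)) (hp j).le
      _ = Real.sqrt (p j ^ 2 * (lamh j / p j * Y)) := by
          rw [Real.sqrt_mul (sq_nonneg _), Real.sqrt_sq (hp j).le]
      _ = Real.sqrt (lamh j * p j * Y) := by congr 1; field_simp
      _ = Real.sqrt (lamh j * p j) * Real.sqrt Y :=
          Real.sqrt_mul (mul_pos (hlamh j) (hp j)).le _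
  have hamgm : c * (S * Real.sqrt Y) ≤ (1 - ρ) / 2 * (Y + (c * S / (1 - ρ)) ^ 2) := by
    have hcS : c * S = (1 - ρ) * (c * S / (1 - ρ)) := by field_simp
    generalize c * S / (1 - ρ) = k at hcS ⊢
    rw [← mul_assoc, hcS]
    nlinarith [mul_nonneg hρ1.le (sq_nonneg (k - Real.sqrt Y)), Real.sq_sqrt hY]
  have hroot : ∑ j, (c * lamh α * p j) * Real.sqrt (z j) =
      lamh α * (c * ∑ j, p j * Real.sqrt (z j)) := by
    simp only [Finset.mul_sum]
    exact Finset.sum_congr rfl fun j _ => by ring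
  have hpα := (hp α).ne'
  calc _ = lamh α * (∑ j, p j * s j * z j + c * ∑ j, p j * Real.sqrt (z j)) +
        (1 - p α) * z α := by rw [hdiag, hroot]; ring
    _ ≤ lamh α * (ρ * Y + (1 - ρ) / 2 * (Y + (c * S / (1 - ρ)) ^ 2)) +
        (1 - p α) * (lamh α / p α * Y) := by
      refine add_le_add (mul_le_mul_of_nonneg_left (add_le_add hlin ?_) (hlamh α).le)
        (mul_le_mul_of_nonneg_left (hz α) (sub_nonneg.2 (hp1 α)))
      exact (mul_le_mul_of_nonneg_left hsqrt hc).trans hamgm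
    _ = _ := by
      generalize (c * S / (1 - ρ)) ^ 2 = K
      field_simp
      ring

/-- Queue-length theorem for the Separate Queues policy (deterministic content):
any nonnegative sequence `x : ℕ → ℝ^m` satisfying the componentwise recursive
inequality `x α (i+1) ≤ ∑ j A α j * x j i + ∑ j B α j * √(x j i)`, with
`A α j = λ̂ α p j s̄ j + (1 - p α) δ_{αj}` and `B α j = c λ̂ α p j`, is bounded
and satisfies
`limsup_i x α i ≤ (c²/(1-ρ)²) (λ̂ α / p α) (∑ j √(λ̂ j p j))²`. -/
theorem stmt_7 (m : ℕ) (hm : 1 ≤ m)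
    (lamh p s : Fin m → ℝ) (hlamh : ∀ j, 0 < lamh j)
    (hp : ∀ j, p j ∈ Set.Ioo (0 : ℝ) 1) (hs : ∀ j, 0 < s j)
    (ρ : ℝ) (hρ : ρ = ∑ j, lamh j * s j) (hload : ρ < 1)
    (c : ℝ) (hc : 0 < c)
    (x : ℕ → Fin m → ℝ) (hx : ∀ i α, 0 ≤ x i α)
    (hrec : ∀ i, ∀ α,
      x (i + 1) α ≤
        (∑ j, (lamh α * p j * s j + (if α = j then 1 - p α else 0)) * x i j) +
        ∑ j, (c * lamh α * p j) * Real.sqrt (x i j)) :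
    (∃ M : ℝ, ∀ i α, x i α ≤ M) ∧
    ∀ α, Filter.limsup (fun i => x i α) Filter.atTop ≤
      (c ^ 2 / (1 - ρ) ^ 2) * (lamh α / p α) *
        (∑ j, Real.sqrt (lamh j * p j)) ^ 2 := by
  have : Nonempty (Fin m) := ⟨⟨0, hm⟩⟩
  have hρ1 : 0 < 1 - ρ := sub_pos.2 hload
  have hρ0 : 0 ≤ ρ := hρ ▸ Finset.sum_nonneg fun j _ => (mul_pos (hlamh j) (hs j)).le
  have hw : ∀ j, 0 < lamh j / p j := fun j => div_pos (hlamh j) (hp j).1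
  obtain ⟨β, hβ⟩ := Finite.exists_min p
  obtain ⟨γ, hγ⟩ := Finite.exists_max fun j => x 0 j / (lamh j / p j)
  set K := (c * (∑ j, Real.sqrt (lamh j * p j)) / (1 - ρ)) ^ 2 with hK
  set D := x 0 γ / (lamh γ / p γ)
  set r := 1 - p β * ((1 - ρ) / 2) with hr
  have hK0 : 0 ≤ K := sq_nonneg _
  have hD0 : 0 ≤ D := div_nonneg (hx 0 γ) (hw γ).le
  have hr0 : 0 ≤ r := by nlinarith [(hp β).1, (hp β).2]
  have hr1 : r < 1 := by nlinarith [mul_pos (hp β).1 hρ1]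
  have hbound : ∀ i α, x i α ≤ lamh α / p α * (K + D * r ^ i) := by
    intro i
    induction i with
    | zero =>
      intro α
      rw [pow_zero, mul_one, ← div_le_iff₀' (hw α)]
      exact (hγ α).trans (le_add_of_nonneg_left hK0)
    | succ i ih =>
      intro α
      have hE : 0 ≤ D * r ^ i := mul_nonneg hD0 (pow_nonneg hr0 i)
      refine (hrec i α).trans <| (separateQueues_step_le hlamh (fun j => (hp j).1)
        (fun j => (hp j).2.le) (fun j => (hs j).le) hρ hload hc.le
        (add_nonneg hK0 hE) ih α).trans ?_
      refine mul_le_mul_of_nonneg_left ?_ (hw α).le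
      rw [← hK, pow_succ, ← mul_assoc, hr]
      nlinarith [mul_le_mul_of_nonneg_right (hβ α) (mul_nonneg hρ1.le hE)]
  refine ⟨?_, fun α => ?_⟩
  · obtain ⟨δ, hδ⟩ := Finite.exists_max fun j => lamh j / p j
    refine ⟨lamh δ / p δ * (K + D), fun i α => (hbound i α).trans ?_⟩
    refine mul_le_mul (hδ α) ?_ (add_nonneg hK0 (mul_nonneg hD0 (pow_nonneg hr0 i))) (hw δ).le
    gcongr
    exact mul_le_of_le_one_right hD0 (pow_le_one₀ hr0 hr1.le)
  · have hlim : Filter.Tendsto (fun i : ℕ => lamh α / p α * (K + D * r ^ i)) Filter.atTop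
        (nhds (lamh α / p α * (K + D * 0))) :=
      (((tendsto_pow_atTop_nhds_zero_of_lt_one hr0 hr1).const_mul D).const_add K).const_mul _
    calc Filter.limsup (fun i => x i α) Filter.atTop
        ≤ Filter.limsup (fun i : ℕ => lamh α / p α * (K + D * r ^ i)) Filter.atTop :=
          Filter.limsup_le_limsup (Filter.Eventually.of_forall fun i => hbound i α)
            (Filter.isCoboundedUnder_le_of_le Filter.atTop fun i => hx i α)
            hlim.isBoundedUnder_le
      _ = lamh α / p α * (K + D * 0) := hlim.limsup_eq
      _ = _ := by rw [hK, div_pow, mul_pow]; ring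
end

section
/- Let m ≥ 1, let λ̂_1, …, λ̂_m > 0, p_1, …, p_m ∈ (0,1), s̄_1, …, s̄_m > 0 with ρ := ∑_{j=1}^m λ̂_j s̄_j < 1, and let c > 0. Then the system of equations p_α y_α = λ̂_α ∑_{j=1}^m p_j (c √(y_j) + s̄_j y_j), for α ∈ {1,…,m}, has a unique solution y ∈ ℝ^m with all components strictly positive, given by y_α = (c^2 / (1−ρ)^2) (λ̂_α / p_α) (∑_{j=1}^m √(λ̂_j p_j))^2; moreover any such solution satisfies the proportionality relation p_α λ̂_1 y_α = p_1 λ̂_α y_1 for all α. -/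
/-- Evaluating the queue-length recursion on the ray `y j = t² * (lamh j / p j)`. -/
theorem sum_queue_recursion_ray {ι : Type*} [Fintype ι] {lamh p s : ι → ℝ}
    (hp : ∀ j, 0 < p j) (c : ℝ) {t : ℝ} (ht : 0 ≤ t) {y : ι → ℝ}
    (hy : ∀ j, y j = t ^ 2 * (lamh j / p j)) :
    ∑ j, p j * (c * √(y j) + s j * y j) =
      c * t * ∑ j, √(lamh j * p j) + t ^ 2 * ∑ j, lamh j * s j := by
  rw [Finset.mul_sum, Finset.mul_sum, ← Finset.sum_add_distrib]
  refine Finset.sum_congr rfl fun j _ => ?_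
  have hpj := hp j
  have hsqrt : p j * √(y j) = t * √(lamh j * p j) := by
    have h : lamh j * p j = p j ^ 2 * (lamh j / p j) := by field_simp
    rw [hy, h, Real.sqrt_mul (sq_nonneg _), Real.sqrt_mul (sq_nonneg _),
      Real.sqrt_sq ht, Real.sqrt_sq hpj.le]
    ring
  have hlin : p j * y j = t ^ 2 * lamh j := by
    rw [hy]
    field_simp
  linear_combination c * hsqrt + s j * hlin


/-- The steady-state fixed point of the Separate Queues queue-length recursion:
the system `p α y α = λ̂ α ∑ j p j (c √(y j) + s̄ j y j)` has a unique strictly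
positive solution, given by
`y α = (c²/(1-ρ)²) (λ̂ α / p α) (∑ j √(λ̂ j p j))²`, and every such solution
satisfies `p α λ̂ 1 y α = p 1 λ̂ α y 1`. -/
theorem stmt_9 (m : ℕ) (hm : 1 ≤ m)
    (lamh p s : Fin m → ℝ) (hlamh : ∀ j, 0 < lamh j)
    (hp : ∀ j, p j ∈ Set.Ioo (0 : ℝ) 1) (hs : ∀ j, 0 < s j)
    (ρ : ℝ) (hρ : ρ = ∑ j, lamh j * s j) (hload : ρ < 1)
    (c : ℝ) (hc : 0 < c)
    (Y : Fin m → ℝ)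
    (hY : ∀ α, Y α = (c ^ 2 / (1 - ρ) ^ 2) * (lamh α / p α) *
        (∑ j, Real.sqrt (lamh j * p j)) ^ 2) :
    ((∀ α, 0 < Y α) ∧
      (∀ α, p α * Y α =
        lamh α * ∑ j, p j * (c * Real.sqrt (Y j) + s j * Y j))) ∧
    (∀ y : Fin m → ℝ, (∀ α, 0 < y α) →
      (∀ α, p α * y α =
        lamh α * ∑ j, p j * (c * Real.sqrt (y j) + s j * y j)) →
      y = Y) ∧
    (∀ y : Fin m → ℝ, (∀ α, 0 < y α) →
      (∀ α, p α * y α =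
        lamh α * ∑ j, p j * (c * Real.sqrt (y j) + s j * y j)) →
      ∀ α, p α * lamh ⟨0, hm⟩ * y α = p ⟨0, hm⟩ * lamh α * y ⟨0, hm⟩) := by
  have hp0 : ∀ j, 0 < p j := fun j => (hp j).1
  have hρ1 : 0 < 1 - ρ := sub_pos.2 hload
  set S := ∑ j, Real.sqrt (lamh j * p j) with hS
  have hSpos : 0 < S :=
    Finset.sum_pos (fun j _ => Real.sqrt_pos.2 (mul_pos (hlamh j) (hp0 j)))
      ⟨⟨0, hm⟩, Finset.mem_univ _⟩
  have hYray : ∀ j, Y j = (c * S / (1 - ρ)) ^ 2 * (lamh j / p j) := fun j => by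
    rw [hY, div_pow, mul_pow]
    ring
  have huniq : ∀ y : Fin m → ℝ, (∀ α, 0 < y α) →
      (∀ α, p α * y α =
        lamh α * ∑ j, p j * (c * Real.sqrt (y j) + s j * y j)) → y = Y := by
    intro y hy hfix
    set K := ∑ j, p j * (c * Real.sqrt (y j) + s j * y j) with hK
    have hKpos : 0 < K := by
      have h := mul_pos (hp0 ⟨0, hm⟩) (hy ⟨0, hm⟩)
      rw [hfix] at h
      exact (mul_pos_iff_of_pos_left (hlamh _)).1 h
    have ht := Real.sqrt_pos.2 hKpos
    have hsq := Real.sq_sqrt hKpos.le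
    have hray : ∀ α, y α = √K ^ 2 * (lamh α / p α) := by
      intro α
      have hpα := (hp0 α).ne'
      rw [hsq]
      field_simp
      linear_combination hfix α
    have hscalar := sum_queue_recursion_ray (s := s) hp0 c ht.le hray
    rw [← hK, ← hS, ← hρ] at hscalar
    have hroot : √K = c * S / (1 - ρ) := by
      rw [eq_div_iff hρ1.ne']
      apply mul_left_cancel₀ ht.ne'
      linear_combination hscalar + hsq
    ext α
    rw [hray, hYray, hroot]
  refine ⟨⟨fun α => ?_, fun α => ?_⟩, huniq, fun y hy hfix α => ?_⟩
  · have := hlamh α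
    have := hp0 α
    rw [hY]
    positivity
  · rw [sum_queue_recursion_ray hp0 c (by positivity) hYray, ← hS, ← hρ, hYray]
    have hpα := (hp0 α).ne'
    field_simp
    ring
  · have hpα := (hp0 α).ne'
    have hp₀ := (hp0 ⟨0, hm⟩).ne'
    rw [huniq y hy hfix, hY, hY]
    field_simp
end
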